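/- arXiv:2107.03155 — 4 statements merged into one kernel-verified Lean document; each statement's English description precedes it below -/
import Mathlib

section
/- The exponential coefficients of a weighted relation are invariant under permutation of the output list: for every α : X → Y → ℝ≥0∞, every μ : Multiset X, and all lists ys, ys' : List Y with the same underlying multiset (↑ys = ↑ys' in Multiset Y), one has S(α, μ, ys) = S(α, μ, ys'). Consequently the exponential !α is a well-defined function Multiset X → Multiset Y → ℝ≥0∞. -/
open scoped ENNReal

/-- The exponential coefficient `S(α, μ, ys)` of a weighted relation
`α : X → Y → ℝ≥0∞` at a multiset `μ : Multiset X` and a list `ys : List Y`: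
the sum, over all lists `xs` of length `ys.length` enumerating `μ`, of the
product of the coefficients `α xsᵢ ysᵢ`. -/
noncomputable def expCoeff {X Y : Type*} (α : X → Y → ℝ≥0∞)
    (μ : Multiset X) (ys : List Y) : ℝ≥0∞ :=
  ∑' xs : {l : List X // l.length = ys.length ∧ (↑l : Multiset X) = μ},
    ∏ i : Fin ys.length, α (xs.1.get (Fin.cast xs.2.1.symm i)) (ys.get i)

/-- Permutation-equivalent lists differ by a bijection of their index types. -/
theorem List.Perm.exists_equiv_get {Y : Type*} {l l' : List Y} (h : l.Perm l') :
    ∃ σ : Fin l.length ≃ Fin l'.length, ∀ i, l'.get (σ i) = l.get i := by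
  induction h with
  | nil => exact ⟨Equiv.refl _, fun _ => rfl⟩
  | @cons a l₁ l₂ _ ih =>
    obtain ⟨σ, hσ⟩ := ih
    refine ⟨((finSuccEquiv _).trans σ.optionCongr).trans (finSuccEquiv _).symm, fun i => ?_⟩
    induction i using Fin.cases with
    | zero => simp
    | succ i => simpa using hσ i
  | swap a b l =>
    refine ⟨Equiv.swap (0 : Fin (l.length + 2)) 1, fun i => ?_⟩
    induction i using Fin.cases with
    | zero => simp [Equiv.swap_apply_left]
    | succ i =>
      induction i using Fin.cases with
      | zero => simp [Equiv.swap_apply_right]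
      | succ i =>
        rw [Equiv.swap_apply_of_ne_of_ne (Fin.succ_ne_zero _)
          (show i.succ.succ ≠ 1 from fun h => Fin.succ_ne_zero i (Fin.succ_injective _ h))]
        rfl
  | trans _ _ ih₁ ih₂ =>
    obtain ⟨σ, hσ⟩ := ih₁
    obtain ⟨τ, hτ⟩ := ih₂
    exact ⟨σ.trans τ, fun i => (hτ (σ i)).trans (hσ i)⟩

/-- Lists of length `n` enumerating `μ` correspond to families `Fin n → X` with image `μ`. -/
def listEnumEquiv {X : Type*} (μ : Multiset X) (n : ℕ) :
    {l : List X // l.length = n ∧ (↑l : Multiset X) = μ} ≃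
      {f : Fin n → X // Finset.univ.val.map f = μ} where
  toFun l := ⟨fun i => l.1.get (Fin.cast l.2.1.symm i), by
    obtain ⟨l, rfl, rfl⟩ := l
    simp⟩
  invFun f := ⟨List.ofFn f.1, by simp, by rw [← Fin.univ_val_map, f.2]⟩
  left_inv := by
    rintro ⟨l, rfl, rfl⟩
    simp
  right_inv f := by
    ext i
    simp

/-- The exponential coefficient as a sum over families of inputs rather than lists. -/
theorem expCoeff_eq_tsum_fin {X Y : Type*} (α : X → Y → ℝ≥0∞) (μ : Multiset X) (ys : List Y) :
    expCoeff α μ ys =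
      ∑' f : {f : Fin ys.length → X // Finset.univ.val.map f = μ},
        ∏ i, α (f.1 i) (ys.get i) :=
  (listEnumEquiv μ ys.length).tsum_eq
    fun f : {f : Fin ys.length → X // Finset.univ.val.map f = μ} => ∏ i, α (f.1 i) (ys.get i)

/-- The exponential coefficients are invariant under permutation of the output
list: if `ys` and `ys'` have the same underlying multiset then
`S(α, μ, ys) = S(α, μ, ys')`. -/
theorem expCoeff_perm_invariant {X Y : Type*} (α : X → Y → ℝ≥0∞)
    (μ : Multiset X) (ys ys' : List Y)
    (h : (↑ys : Multiset Y) = ↑ys') :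
    expCoeff α μ ys = expCoeff α μ ys' := by
  obtain ⟨σ, hσ⟩ := (Multiset.coe_eq_coe.mp h).exists_equiv_get
  rw [expCoeff_eq_tsum_fin, expCoeff_eq_tsum_fin]
  let e : {f : Fin ys.length → X // Finset.univ.val.map f = μ} ≃
      {f : Fin ys'.length → X // Finset.univ.val.map f = μ} :=
    (σ.arrowCongr (Equiv.refl X)).subtypeEquiv fun f => by
      have hf : Finset.univ.val.map (f ∘ σ.symm) = Finset.univ.val.map f := by
        rw [← Multiset.map_map, Multiset.map_univ_val_equiv]
      exact (congrArg (· = μ) hf).symm.to_iff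
  rw [← e.tsum_eq]
  refine tsum_congr fun f => ?_
  rw [← σ.prod_comp]
  refine Finset.prod_congr rfl fun i _ => ?_
  have he : (e f).1 (σ i) = f.1 i := congrArg f.1 (σ.symm_apply_apply i)
  rw [hσ, he]
end

section
/- The exponential preserves identities: for any type X, let id_X : X → X → ℝ≥0∞ be defined by id_X x x' = 1 if x = x' and 0 otherwise. Then for every μ : Multiset X and every list ys : List X, S(id_X, μ, ys) = 1 if (↑ys : Multiset X) = μ and S(id_X, μ, ys) = 0 otherwise; that is, !(id_X) is the identity weighted relation on Multiset X. -/
open scoped ENNReal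

theorem prod_ite_get_eq {X : Type*} [DecidableEq X] {R : Type*} [CommMonoidWithZero R]
    (xs ys : List X) (h : xs.length = ys.length) :
    ∏ i : Fin ys.length,
        (if xs.get (Fin.cast h.symm i) = ys.get i then (1 : R) else 0)
      = if xs = ys then 1 else 0 := by
  split_ifs with e
  · subst e
    exact Finset.prod_eq_one fun i _ => if_pos rfl
  · obtain ⟨i, hi⟩ : ∃ i, xs.get (Fin.cast h.symm i) ≠ ys.get i := by
      by_contra! hi
      exact e (List.ext_get h fun n _ hy => hi ⟨n, hy⟩)
    exact Finset.prod_eq_zero (Finset.mem_univ i) (if_neg hi)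

/-- The exponential preserves identities: `!(id_X)` is the identity weighted
relation on `Multiset X`. -/
theorem expCoeff_id {X : Type*} [DecidableEq X] (μ : Multiset X) (ys : List X) :
    expCoeff (fun x x' => if x = x' then (1 : ℝ≥0∞) else 0) μ ys
      = if (↑ys : Multiset X) = μ then (1 : ℝ≥0∞) else 0 := by
  rw [expCoeff, tsum_congr fun xs : {l : List X // l.length = ys.length ∧ (↑l : Multiset X) = μ} =>
    prod_ite_get_eq xs.1 ys xs.2.1]
  split_ifs with h
  · rw [tsum_eq_single ⟨ys, rfl, h⟩ fun xs hxs => if_neg fun e => hxs (Subtype.ext e)]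
    exact if_pos rfl
  · refine ENNReal.tsum_eq_zero.2 fun xs => if_neg fun e => h ?_
    rw [← e, xs.2.2]
end

section
/- The exponential of ℝ≥0∞-weighted relations is functorial: let α : X → Y → ℝ≥0∞ and β : Y → Z → ℝ≥0∞, and let Fα : Multiset X → Multiset Y → ℝ≥0∞ and Fβ : Multiset Y → Multiset Z → ℝ≥0∞ be functions satisfying Fα μ (↑ys) = S(α, μ, ys) for all μ : Multiset X and ys : List Y, and Fβ ν (↑zs) = S(β, ν, zs) for all ν : Multiset Y and zs : List Z. Then for every μ : Multiset X and every zs : List Z, S(β ∘ α, μ, zs) = ∑' (ν : Multiset Y), Fα μ ν * Fβ ν (↑zs), where (β ∘ α) x z = ∑' (y : Y), α x y * β y z; that is, !(β ∘ α) = (!β) ∘ (!α). -/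
open scoped ENNReal

/-- The weight of a pair of lists: the product of the weights of their entries if the lists have
the same length, and `0` otherwise. -/
noncomputable def listWeight {X Y : Type*} (α : X → Y → ℝ≥0∞) : List X → List Y → ℝ≥0∞
  | [], [] => 1
  | x :: xs, y :: ys => α x y * listWeight α xs ys
  | [], _ :: _ => 0
  | _ :: _, [] => 0

theorem listWeight_of_length_ne {X Y : Type*} (α : X → Y → ℝ≥0∞) (xs : List X) (ys : List Y)
    (h : xs.length ≠ ys.length) : listWeight α xs ys = 0 := by
  induction xs generalizing ys with
  | nil => cases ys <;> simp_all [listWeight]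
  | cons x xs ih => cases ys <;> simp_all [listWeight]

theorem listWeight_eq_prod {X Y : Type*} (α : X → Y → ℝ≥0∞) (xs : List X) (ys : List Y)
    (h : xs.length = ys.length) :
    listWeight α xs ys = ∏ i : Fin ys.length, α (xs.get (Fin.cast h.symm i)) (ys.get i) := by
  induction xs generalizing ys with
  | nil =>
    cases ys with
    | nil => simp [listWeight]
    | cons y ys => simp at h
  | cons x xs ih =>
    cases ys with
    | nil => simp at h
    | cons y ys =>
      rw [listWeight, ih ys (by simpa using h)]
      exact (Fin.prod_univ_succ (n := ys.length)
        fun i => α ((x :: xs).get (Fin.cast h.symm i)) ((y :: ys).get i)).symm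

open Classical in
theorem expCoeff_eq_tsum_listWeight {X Y : Type*} (α : X → Y → ℝ≥0∞) (μ : Multiset X)
    (ys : List Y) :
    expCoeff α μ ys = ∑' xs : List X, if (↑xs : Multiset X) = μ then listWeight α xs ys else 0 := by
  rw [expCoeff, ← Subtype.val_injective.tsum_eq
    (g := (Subtype.val : {l : List X // l.length = ys.length ∧ (↑l : Multiset X) = μ} → List X))]
  · exact tsum_congr fun xs => by rw [if_pos xs.2.2, listWeight_eq_prod α xs.1 ys xs.2.1]
  · intro xs hxs
    rw [Function.mem_support, ne_eq, ite_eq_right_iff, Classical.not_imp] at hxs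
    exact ⟨⟨xs, not_not.1 (mt (listWeight_of_length_ne α xs ys) hxs.2), hxs.1⟩, rfl⟩

theorem listWeight_comp {X Y Z : Type*} (α : X → Y → ℝ≥0∞) (β : Y → Z → ℝ≥0∞)
    (xs : List X) (zs : List Z) :
    listWeight (fun x z => ∑' y : Y, α x y * β y z) xs zs
      = ∑' ys : List Y, listWeight α xs ys * listWeight β ys zs := by
  induction xs generalizing zs with
  | nil =>
    rw [tsum_eq_single []]
    · cases zs <;> simp [listWeight]
    · intro ys hys
      cases ys <;> simp_all [listWeight]
  | cons x xs ih =>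
    have hinj : Function.Injective fun p : Y × List Y => p.1 :: p.2 := by
      rintro ⟨y, ys⟩ ⟨y', ys'⟩ h
      simpa using h
    rw [← hinj.tsum_eq]
    · cases zs with
      | nil => simp [listWeight]
      | cons z zs =>
        simp only [listWeight, ih]
        rw [ENNReal.tsum_prod (f := fun y ys =>
          α x y * listWeight α xs ys * (β y z * listWeight β ys zs)), ← ENNReal.tsum_mul_right]
        refine tsum_congr fun y => ?_
        rw [← ENNReal.tsum_mul_left]
        exact tsum_congr fun ys => mul_mul_mul_comm _ _ _ _
    · intro ys hys
      cases ys with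
      | nil => simp [listWeight] at hys
      | cons y ys => exact ⟨(y, ys), rfl⟩

/-- The exponential of `ℝ≥0∞`-weighted relations preserves composition:
`!(β ∘ α) = (!β) ∘ (!α)`, where `Fα` and `Fβ` are the (well-defined)
exponentials of `α` and `β`. -/
theorem expCoeff_comp {X Y Z : Type*}
    (α : X → Y → ℝ≥0∞) (β : Y → Z → ℝ≥0∞)
    (Fα : Multiset X → Multiset Y → ℝ≥0∞) (Fβ : Multiset Y → Multiset Z → ℝ≥0∞)
    (hFα : ∀ (μ : Multiset X) (ys : List Y), Fα μ (↑ys) = expCoeff α μ ys)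
    (hFβ : ∀ (ν : Multiset Y) (zs : List Z), Fβ ν (↑zs) = expCoeff β ν zs)
    (μ : Multiset X) (zs : List Z) :
    expCoeff (fun x z => ∑' y : Y, α x y * β y z) μ zs
      = ∑' ν : Multiset Y, Fα μ ν * Fβ ν (↑zs) := by
  classical
  have key : ∀ ν : Multiset Y, Fα μ ν * Fβ ν (↑zs)
      = ∑' ys : List Y, if (↑ys : Multiset Y) = ν then
          expCoeff α μ ys * listWeight β ys zs else 0 := by
    intro ν
    rw [hFβ, expCoeff_eq_tsum_listWeight, ← ENNReal.tsum_mul_left]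
    refine tsum_congr fun ys => ?_
    split_ifs with h
    · rw [← hFα, h]
    · exact mul_zero _
  simp_rw [key]
  rw [ENNReal.tsum_comm, expCoeff_eq_tsum_listWeight]
  simp_rw [tsum_ite_eq', expCoeff_eq_tsum_listWeight α, ← ENNReal.tsum_mul_right, listWeight_comp]
  rw [ENNReal.tsum_comm]
  refine tsum_congr fun xs => ?_
  split_ifs <;> simp
end

section
/- The exponential of a direct sum of ℝ≥0∞-weighted relations splits as a product (monoidality of ! with respect to the Seely isomorphism): let α : X → X' → ℝ≥0∞ and β : Y → Y' → ℝ≥0∞, and define (α ⊕ β) : (X ⊕ Y) → (X' ⊕ Y') → ℝ≥0∞ by (α ⊕ β) (inl x) (inl x') = α x x', (α ⊕ β) (inr y) (inr y') = β y y', and (α ⊕ β) = 0 on mixed pairs. Then for every μ : Multiset X, ν : Multiset Y, xs' : List X', ys' : List Y', one has S(α ⊕ β, (μ.map Sum.inl) + (ν.map Sum.inr), (xs'.map Sum.inl) ++ (ys'.map Sum.inr)) = S(α, μ, xs') * S(β, ν, ys'). -/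
open scoped ENNReal

/-- The direct sum of two weighted relations: `α` on `inl`-pairs, `β` on
`inr`-pairs, `0` on mixed pairs. -/
def sumRel {X X' Y Y' : Type*} (α : X → X' → ℝ≥0∞) (β : Y → Y' → ℝ≥0∞) :
    X ⊕ Y → X' ⊕ Y' → ℝ≥0∞
  | Sum.inl x, Sum.inl x' => α x x'
  | Sum.inr y, Sum.inr y' => β y y'
  | Sum.inl _, Sum.inr _ => 0
  | Sum.inr _, Sum.inl _ => 0

theorem prod_get_eq_prod_zipWith {X Y : Type*} (α : X → Y → ℝ≥0∞) (xs : List X) (ys : List Y)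
    (h : xs.length = ys.length) :
    ∏ i : Fin ys.length, α (xs.get (Fin.cast h.symm i)) (ys.get i)
      = (List.zipWith α xs ys).prod := by
  induction ys generalizing xs with
  | nil => simp
  | cons y ys ih =>
    cases xs with
    | nil => simp at h
    | cons x xs =>
      have h' : xs.length = ys.length := by simpa using h
      rw [List.zipWith_cons_cons, List.prod_cons, ← ih xs h']
      exact Fin.prod_univ_succ _

theorem expCoeff_eq_tsum_prod_zipWith {X Y : Type*} (α : X → Y → ℝ≥0∞)
    (μ : Multiset X) (ys : List Y) :
    expCoeff α μ ys = ∑' xs : {l : List X // l.length = ys.length ∧ (↑l : Multiset X) = μ},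
      (List.zipWith α xs.1 ys).prod :=
  tsum_congr fun xs => prod_get_eq_prod_zipWith α xs.1 ys xs.2.1

section

variable {X X' Y Y' : Type*} (α : X → X' → ℝ≥0∞) (β : Y → Y' → ℝ≥0∞)

theorem prod_zipWith_sumRel (as : List X) (bs : List Y) (xs' : List X') (ys' : List Y')
    (h : as.length = xs'.length) :
    (List.zipWith (sumRel α β) (as.map Sum.inl ++ bs.map Sum.inr)
        (xs'.map Sum.inl ++ ys'.map Sum.inr)).prod
      = (List.zipWith α as xs').prod * (List.zipWith β bs ys').prod := by
  rw [List.zipWith_append (by simpa using h), List.prod_append]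
  simp [List.zipWith_map, sumRel]

theorem exists_eq_map_inr_of_prod_zipWith_sumRel_ne_zero (l : List (X ⊕ Y)) (ys' : List Y')
    (hl : l.length = ys'.length)
    (h : (List.zipWith (sumRel α β) l (ys'.map Sum.inr)).prod ≠ 0) :
    ∃ bs : List Y, bs.length = ys'.length ∧ l = bs.map Sum.inr := by
  induction ys' generalizing l with
  | nil => exact ⟨[], rfl, by simpa using hl⟩
  | cons y' ys' ih =>
    rcases l with _ | ⟨x | y, l⟩
    · simp at hl
    · simp [sumRel] at h
    · obtain ⟨bs, hbs, rfl⟩ := ih l (by simpa using hl) (right_ne_zero_of_mul (by simpa using h))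
      exact ⟨y :: bs, by simp [hbs], rfl⟩

theorem exists_eq_append_of_prod_zipWith_sumRel_ne_zero (l : List (X ⊕ Y))
    (xs' : List X') (ys' : List Y') (hl : l.length = xs'.length + ys'.length)
    (h : (List.zipWith (sumRel α β) l (xs'.map Sum.inl ++ ys'.map Sum.inr)).prod ≠ 0) :
    ∃ (as : List X) (bs : List Y), as.length = xs'.length ∧ bs.length = ys'.length ∧
      l = as.map Sum.inl ++ bs.map Sum.inr := by
  induction xs' generalizing l with
  | nil =>
    obtain ⟨bs, hbs, rfl⟩ := exists_eq_map_inr_of_prod_zipWith_sumRel_ne_zero α β l ys'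
      (by simpa using hl) (by simpa using h)
    exact ⟨[], bs, rfl, hbs, rfl⟩
  | cons x' xs' ih =>
    rcases l with _ | ⟨x | y, l⟩
    · simp at hl
      omega
    · obtain ⟨as, bs, has, hbs, rfl⟩ := ih l (by simp at hl; omega)
        (right_ne_zero_of_mul (by simpa using h))
      exact ⟨x :: as, bs, by simp [has], hbs, rfl⟩
    · simp [sumRel] at h

end

theorem Multiset.filterMap_const_none {X Y : Type*} (μ : Multiset X) :
    μ.filterMap (fun _ => (none : Option Y)) = 0 := by
  induction μ using Multiset.induction <;> simp_all

theorem Multiset.map_inl_add_map_inr_inj {X Y : Type*} {μ μ' : Multiset X} {ν ν' : Multiset Y} :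
    μ.map (Sum.inl : X → X ⊕ Y) + ν.map (Sum.inr : Y → X ⊕ Y)
      = μ'.map Sum.inl + ν'.map Sum.inr ↔ μ = μ' ∧ ν = ν' := by
  refine ⟨fun h => ⟨?_, ?_⟩, by rintro ⟨rfl, rfl⟩; rfl⟩
  · simpa [Multiset.filterMap_add, Multiset.filterMap_map, Function.comp_def,
      Multiset.filterMap_const_none] using
      congrArg (Multiset.filterMap Sum.getLeft?) h
  · simpa [Multiset.filterMap_add, Multiset.filterMap_map, Function.comp_def,
      Multiset.filterMap_const_none] using
      congrArg (Multiset.filterMap Sum.getRight?) h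

theorem List.map_inl_append_map_inr_inj {X Y : Type*} {as as' : List X} {bs bs' : List Y} :
    as.map (Sum.inl : X → X ⊕ Y) ++ bs.map (Sum.inr : Y → X ⊕ Y)
      = as'.map Sum.inl ++ bs'.map Sum.inr ↔ as = as' ∧ bs = bs' := by
  refine ⟨fun h => ⟨?_, ?_⟩, by rintro ⟨rfl, rfl⟩; rfl⟩
  · simpa [List.filterMap_map, Function.comp_def] using
      congrArg (List.filterMap Sum.getLeft?) h
  · simpa [List.filterMap_map, Function.comp_def] using
      congrArg (List.filterMap Sum.getRight?) h

/-- The exponential of a direct sum of weighted relations splits as a product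
(monoidality of `!` with respect to the Seely isomorphism). -/
theorem expCoeff_sumRel {X X' Y Y' : Type*}
    (α : X → X' → ℝ≥0∞) (β : Y → Y' → ℝ≥0∞)
    (μ : Multiset X) (ν : Multiset Y) (xs' : List X') (ys' : List Y') :
    expCoeff (sumRel α β)
        (μ.map (Sum.inl : X → X ⊕ Y) + ν.map (Sum.inr : Y → X ⊕ Y))
        (xs'.map (Sum.inl : X' → X' ⊕ Y') ++ ys'.map (Sum.inr : Y' → X' ⊕ Y'))
      = expCoeff α μ xs' * expCoeff β ν ys' := by
  simp only [expCoeff_eq_tsum_prod_zipWith]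
  rw [← ENNReal.tsum_mul_right]
  simp only [← ENNReal.tsum_mul_left]
  rw [← ENNReal.tsum_prod]
  let e : {l : List X // l.length = xs'.length ∧ (↑l : Multiset X) = μ} ×
      {l : List Y // l.length = ys'.length ∧ (↑l : Multiset Y) = ν} →
      {l : List (X ⊕ Y) // l.length = (xs'.map (Sum.inl : X' → X' ⊕ Y') ++
          ys'.map (Sum.inr : Y' → X' ⊕ Y')).length ∧
        (↑l : Multiset (X ⊕ Y)) = μ.map Sum.inl + ν.map Sum.inr} := fun p =>
    ⟨p.1.1.map Sum.inl ++ p.2.1.map Sum.inr, by simp [p.1.2.1, p.2.2.1], by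
      rw [← Multiset.coe_add, ← Multiset.map_coe, ← Multiset.map_coe, p.1.2.2, p.2.2.2]⟩
  have he : Function.Injective e := fun p q h => by
    obtain ⟨h₁, h₂⟩ := List.map_inl_append_map_inr_inj.1 (congrArg Subtype.val h)
    exact Prod.ext (Subtype.ext h₁) (Subtype.ext h₂)
  rw [← he.tsum_eq]
  · exact tsum_congr fun p => prod_zipWith_sumRel α β p.1.1 p.2.1 xs' ys' p.1.2.1
  · rintro ⟨l, hl, hm⟩ h
    obtain ⟨as, bs, has, hbs, rfl⟩ :=
      exists_eq_append_of_prod_zipWith_sumRel_ne_zero α β l xs' ys' (by simpa using hl) h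
    rw [← Multiset.coe_add, ← Multiset.map_coe, ← Multiset.map_coe,
      Multiset.map_inl_add_map_inr_inj] at hm
    exact ⟨(⟨as, has, hm.1⟩, ⟨bs, hbs, hm.2⟩), rfl⟩
end
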